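/- If X is a compact metric space and φ : X → X is continuous with positive topological entropy, then the push-forward map φ_# on W_p(X) has metric mean dimension bounded below by p·h_top(φ)/log 2. -/

import Mathlib

open MeasureTheory ENNReal

/-- `π` is a coupling of `μ` and `ν`. -/
def IsCoupling {X : Type*} [MeasurableSpace X] (μ ν : Measure X)
    (π : Measure (X × X)) : Prop :=
  π.map Prod.fst = μ ∧ π.map Prod.snd = ν

/-- The `L^p` Wasserstein distance between two measures, as the infimal `p`-cost
over all couplings, to the power `1/p`. -/
noncomputable def Wp {X : Type*} [MetricSpace X] [MeasurableSpace X]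
    (p : ℝ) (μ ν : Measure X) : ℝ≥0∞ :=
  (⨅ (π : Measure (X × X)) (_ : IsCoupling μ ν π),
    ∫⁻ z, ENNReal.ofReal (dist z.1 z.2 ^ p) ∂π) ^ (1 / p)

open Filter Topology

/-- Maximal cardinality of an `(n,ε)`-separated set for a self-map `ψ`, with
respect to a (possibly extended) distance `ρ`. -/
noncomputable def sepCount {Y : Type*} (ρ : Y → Y → ℝ≥0∞) (ψ : Y → Y)
    (ε : ℝ) (n : ℕ) : ℕ :=
  sSup {m | ∃ S : Finset Y, S.card = m ∧ ∀ x ∈ S, ∀ y ∈ S, x ≠ y →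
    ∃ i ≤ n, ENNReal.ofReal ε ≤ ρ (ψ^[i] x) (ψ^[i] y)}

/-- Topological entropy of a continuous self-map of a compact metric space,
via separated sets. -/
noncomputable def htop {X : Type*} [MetricSpace X] (φ : X → X) : ℝ≥0∞ :=
  ⨆ (ε : ℝ) (_ : 0 < ε),
    Filter.limsup (fun n : ℕ =>
      ENNReal.ofReal
        (Real.log (sepCount (fun x y => ENNReal.ofReal (dist x y)) φ ε n) / n))
      Filter.atTop

/-- Metric mean dimension of a self-map with respect to a distance `ρ`. -/
noncomputable def mdimM {Y : Type*} (ρ : Y → Y → ℝ≥0∞) (ψ : Y → Y) : ℝ≥0∞ :=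
  Filter.liminf (fun ε : ℝ =>
    Filter.limsup (fun n : ℕ =>
      ENNReal.ofReal (Real.log (sepCount ρ ψ ε n) / (n * |Real.log ε|)))
      Filter.atTop) (𝓝[>] (0:ℝ))


/-- Atomic measure with binary weights. -/
noncomputable def atm {X : Type*} [MeasurableSpace X] (J : ℕ) (a : Fin J → X) : Measure X :=
  ((2 ^ J - 1 : ℕ) : ℝ≥0∞)⁻¹ • ∑ j : Fin J, ((2 ^ (j : ℕ) : ℕ) : ℝ≥0∞) • Measure.dirac (a j)

open Classical in
lemma atm_apply {X : Type*} [MeasurableSpace X] (J : ℕ) (a : Fin J → X) (A : Set X)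
    (hA : MeasurableSet A) :
    atm J a A = ((2 ^ J - 1 : ℕ) : ℝ≥0∞)⁻¹ *
      ((∑ j ∈ Finset.univ.filter (fun j => a j ∈ A), 2 ^ (j : ℕ) : ℕ) : ℝ≥0∞) := by
  unfold atm
  rw [Measure.smul_apply, Measure.finsetSum_apply, smul_eq_mul, Nat.cast_sum, Finset.sum_filter]
  congr 1
  apply Finset.sum_congr rfl
  intro j _
  rw [Measure.smul_apply, Measure.dirac_apply' _ hA]
  by_cases h : a j ∈ A <;> simp [h]

lemma atm_zero {X : Type*} [MeasurableSpace X] (J : ℕ) (a : Fin J → X) (A : Set X)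
    (hA : MeasurableSet A) (h : ∀ j, a j ∉ A) : atm J a A = 0 := by
  classical
  rw [atm_apply _ _ _ hA]
  simp [h]

lemma atm_map {X : Type*} [MeasurableSpace X] (J : ℕ) (a : Fin J → X) (f : X → X)
    (hf : Measurable f) : (atm J a).map f = atm J (f ∘ a) := by
  classical
  ext A hA
  rw [Measure.map_apply hf hA, atm_apply _ _ _ hA, atm_apply _ _ _ (hf hA)]
  rfl

lemma sum_two_pow_fin (J : ℕ) : ∑ j : Fin J, 2 ^ (j : ℕ) = 2 ^ J - 1 := by
  rw [Fin.sum_univ_eq_sum_range (fun j => 2 ^ j)]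
  have := Nat.geomSum_eq (le_refl 2) J
  simpa using this

lemma atm_prob {X : Type*} [MeasurableSpace X] (J : ℕ) (hJ : 1 ≤ J) (a : Fin J → X) :
    IsProbabilityMeasure (atm J a) := by
  classical
  constructor
  rw [atm_apply _ _ _ MeasurableSet.univ]
  simp only [Set.mem_univ, Finset.filter_true, sum_two_pow_fin]
  apply ENNReal.inv_mul_cancel
  · have : 2 ^ 1 ≤ 2 ^ J := Nat.pow_le_pow_right (by norm_num) hJ
    have h2 : 2 ^ J - 1 ≠ 0 := by omega
    exact_mod_cast h2
  · exact ENNReal.natCast_ne_top _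

lemma coupling_cross {X : Type*} [MeasurableSpace X] {μ ν : Measure X} {π : Measure (X × X)}
    (h : IsCoupling μ ν π) {A B : Set X} (hA : MeasurableSet A) (hB : MeasurableSet B)
    (hν : ν (A ∪ B)ᶜ = 0) : μ A ≤ ν A + π (A ×ˢ B) := by
  obtain ⟨h1, h2⟩ := h
  rw [← h1, Measure.map_apply measurable_fst hA]
  have e0 : π (Prod.snd ⁻¹' (A ∪ B)ᶜ) = 0 := by
    rw [← Measure.map_apply measurable_snd (hA.union hB).compl, h2, hν]
  have e1 : π (Prod.snd ⁻¹' A) = ν A := by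
    rw [← Measure.map_apply measurable_snd hA, h2]
  calc π (Prod.fst ⁻¹' A) ≤ π ((Prod.snd ⁻¹' A ∪ A ×ˢ B) ∪ Prod.snd ⁻¹' (A ∪ B)ᶜ) := by
        apply measure_mono
        rintro ⟨x, y⟩ hx
        simp only [Set.mem_preimage, Set.mem_union, Set.mem_prod, Set.mem_compl_iff] at hx ⊢
        tauto
    _ ≤ π (Prod.snd ⁻¹' A) + π (A ×ˢ B) + π (Prod.snd ⁻¹' (A ∪ B)ᶜ) :=
        (measure_union_le _ _).trans (add_le_add_left (measure_union_le _ _) _)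
    _ = ν A + π (A ×ˢ B) := by rw [e0, e1, add_zero]

lemma coupling_swap {X : Type*} [MeasurableSpace X] {μ ν : Measure X} {π : Measure (X × X)}
    (h : IsCoupling μ ν π) : IsCoupling ν μ (π.map Prod.swap) := by
  obtain ⟨h1, h2⟩ := h
  constructor
  · rw [Measure.map_map measurable_fst measurable_swap]; exact h2
  · rw [Measure.map_map measurable_snd measurable_swap]; exact h1

lemma exists_gap (J : ℕ) (r : ℝ) (hr : 0 < r) (u v : Fin J → ℝ) :
    ∃ k : ℕ, k < 2 * J + 1 ∧ ∀ j, (¬ (k * r < u j ∧ u j < (k + 1) * r)) ∧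
      (¬ (k * r < v j ∧ v j < (k + 1) * r)) := by
  classical
  set T : Finset ℕ := (Finset.univ.image fun j => ⌊u j / r⌋₊) ∪
    (Finset.univ.image fun j => ⌊v j / r⌋₊) with hT
  have hc : T.card < (Finset.range (2 * J + 1)).card := by
    have h1 : (Finset.univ.image fun j => ⌊u j / r⌋₊).card ≤ J := by
      simpa using Finset.card_image_le (s := Finset.univ) (f := fun j => ⌊u j / r⌋₊)
    have h2 : (Finset.univ.image fun j => ⌊v j / r⌋₊).card ≤ J := by
      simpa using Finset.card_image_le (s := Finset.univ) (f := fun j => ⌊v j / r⌋₊)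
    have := Finset.card_union_le (Finset.univ.image fun j => ⌊u j / r⌋₊)
      (Finset.univ.image fun j => ⌊v j / r⌋₊)
    rw [Finset.card_range, hT]
    omega
  obtain ⟨k, hk, hkT⟩ := Finset.exists_mem_notMem_of_card_lt_card hc
  have key : ∀ w : ℝ, k * r < w ∧ w < (k + 1) * r → ⌊w / r⌋₊ = k := by
    rintro w ⟨h1, h2⟩
    rw [Nat.floor_eq_iff (by have : (0:ℝ) ≤ k * r := by positivity
                             exact div_nonneg (by linarith) hr.le)]
    rw [le_div_iff₀ hr, div_lt_iff₀ hr]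
    exact ⟨h1.le, h2⟩
  refine ⟨k, Finset.mem_range.mp hk, fun j => ⟨fun h => hkT ?_, fun h => hkT ?_⟩⟩
  · rw [hT]
    exact Finset.mem_union_left _ (Finset.mem_image.mpr ⟨j, Finset.mem_univ _, key _ h⟩)
  · rw [hT]
    exact Finset.mem_union_right _ (Finset.mem_image.mpr ⟨j, Finset.mem_univ _, key _ h⟩)

/-- distinct index sets give masses that differ by at least `1/(2^J-1)`. -/
lemma sum_pow_ne {J : ℕ} {s t : Finset (Fin J)} (h : s ≠ t) :
    ∑ j ∈ s, 2 ^ (j : ℕ) ≠ ∑ j ∈ t, 2 ^ (j : ℕ) := by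
  intro he
  apply h
  have h1 : ∀ s : Finset (Fin J), ∑ j ∈ s, 2 ^ (j : ℕ) =
      ∑ i ∈ s.map Fin.valEmbedding, 2 ^ i := fun s => by simp
  rw [h1 s, h1 t] at he
  exact Finset.map_injective _ (Finset.geomSum_injective (le_refl 2) he)

lemma mass_gap {c : ℝ≥0∞} {m n : ℕ} (hc : c ≠ ⊤) {q : ℝ≥0∞}
    (hmn : m < n) (h : c * (n : ℝ≥0∞) ≤ c * m + q) : c ≤ q := by
  have h1 : c * (m : ℝ≥0∞) + c ≤ c * m + q := by
    refine le_trans ?_ h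
    have : ((m + 1 : ℕ) : ℝ≥0∞) ≤ n := by exact_mod_cast hmn
    calc c * (m : ℝ≥0∞) + c = c * ((m + 1 : ℕ) : ℝ≥0∞) := by push_cast; ring
      _ ≤ _ := by gcongr
  exact (ENNReal.add_le_add_iff_left (ENNReal.mul_ne_top hc (ENNReal.natCast_ne_top m))).mp h1

lemma cost_lower {X : Type*} [MetricSpace X] [CompactSpace X] [MeasurableSpace X] [BorelSpace X]
    (p : ℝ) (hp : 1 ≤ p) (J : ℕ) (hJ : 1 ≤ J) (a b : Fin J → X) (r : ℝ) (hr : 0 < r)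
    (j0 : Fin J) (hj : (2 * J + 1) * r ≤ dist (a j0) (b j0))
    (π : Measure (X × X)) (hπ : IsCoupling (atm J a) (atm J b) π) :
    ENNReal.ofReal (r ^ p) * ((2 ^ J - 1 : ℕ) : ℝ≥0∞)⁻¹ ≤
      ∫⁻ z, ENNReal.ofReal (dist z.1 z.2 ^ p) ∂π := by
  classical
  have hne : ((2 ^ J - 1 : ℕ) : ℝ≥0∞)⁻¹ ≠ ⊤ := by
    have : 2 ^ 1 ≤ 2 ^ J := Nat.pow_le_pow_right (by norm_num) hJ
    have h2 : 2 ^ J - 1 ≠ 0 := by omega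
    rw [ENNReal.inv_ne_top]
    exact_mod_cast h2
  obtain ⟨k, hk, hgap⟩ := exists_gap J r hr (fun j => dist (a j) (a j0)) (fun j => dist (b j) (a j0))
  set A : Set X := {x | dist x (a j0) ≤ k * r} with hAdef
  set B : Set X := {x | (k + 1) * r ≤ dist x (a j0)} with hBdef
  have hA : MeasurableSet A := (isClosed_le (by fun_prop) (by fun_prop)).measurableSet
  have hB : MeasurableSet B := (isClosed_le (by fun_prop) (by fun_prop)).measurableSet
  have hAB : MeasurableSet (A ∪ B)ᶜ := (hA.union hB).compl
  have hdist : ∀ x ∈ A, ∀ y ∈ B, r ≤ dist x y := by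
    intro x hx y hy
    simp only [hAdef, hBdef, Set.mem_ofPred_eq] at hx hy
    have := dist_triangle y x (a j0)
    rw [dist_comm y x] at this
    nlinarith
  have hzero : ∀ c : Fin J → X, (∀ j, ¬ (k * r < dist (c j) (a j0) ∧
      dist (c j) (a j0) < (k + 1) * r)) → atm J c (A ∪ B)ᶜ = 0 := by
    intro c hc
    apply atm_zero _ _ _ hAB
    intro j hmem
    apply hc j
    simpa [hAdef, hBdef] using hmem
  have ha0 := hzero a (fun j => (hgap j).1)
  have hb0 := hzero b (fun j => (hgap j).2)
  have hcost : ∀ E : Set (X × X), (∀ z ∈ E, r ≤ dist z.1 z.2) → MeasurableSet E →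
      ENNReal.ofReal (r ^ p) * π E ≤ ∫⁻ z, ENNReal.ofReal (dist z.1 z.2 ^ p) ∂π := by
    intro E hE hm
    rw [← setLIntegral_const]
    refine le_trans (setLIntegral_mono' hm ?_) (setLIntegral_le_lintegral _ _)
    intro z hz
    exact ENNReal.ofReal_le_ofReal (Real.rpow_le_rpow hr.le (hE z hz) (by linarith))
  have hset : (Finset.univ.filter (fun j => a j ∈ A)) ≠ (Finset.univ.filter (fun j => b j ∈ A)) := by
    intro he
    have h1 : j0 ∈ Finset.univ.filter (fun j => a j ∈ A) := by
      simp only [Finset.mem_filter, Finset.mem_univ, true_and, hAdef, Set.mem_ofPred_eq, dist_self]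
      positivity
    rw [he] at h1
    simp only [Finset.mem_filter, Finset.mem_univ, true_and, hAdef, Set.mem_ofPred_eq] at h1
    rw [dist_comm] at h1
    have hk' : (k : ℝ) < 2 * J + 1 := by exact_mod_cast hk
    nlinarith
  rcases lt_or_gt_of_ne (sum_pow_ne hset) with hlt | hlt
  · have := coupling_cross (coupling_swap hπ) hA hB ha0
    rw [atm_apply _ _ _ hA, atm_apply _ _ _ hA] at this
    have hq := mass_gap hne hlt this
    rw [Measure.map_apply measurable_swap (hA.prod hB)] at hq
    refine le_trans (mul_le_mul_right hq _) (hcost _ ?_ (measurable_swap (hA.prod hB)))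
    rintro ⟨x, y⟩ ⟨hx, hy⟩
    rw [dist_comm]
    exact hdist _ hx _ hy
  · have := coupling_cross hπ hA hB hb0
    rw [atm_apply _ _ _ hA, atm_apply _ _ _ hA] at this
    have hq := mass_gap hne hlt this
    refine le_trans (mul_le_mul_right hq _) (hcost _ ?_ (hA.prod hB))
    rintro ⟨x, y⟩ ⟨hx, hy⟩
    exact hdist _ hx _ hy

lemma Wp_lower {X : Type*} [MetricSpace X] [CompactSpace X] [MeasurableSpace X] [BorelSpace X]
    (p : ℝ) (hp : 1 ≤ p) (J : ℕ) (hJ : 1 ≤ J) (a b : Fin J → X) (r : ℝ) (hr : 0 < r)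
    (j0 : Fin J) (hj : (2 * J + 1) * r ≤ dist (a j0) (b j0)) (ε : ℝ) (hε : 0 < ε)
    (hεr : ε ^ p * 2 ^ J ≤ r ^ p) :
    ENNReal.ofReal ε ≤ Wp p (atm J a) (atm J b) := by
  have hp0 : 0 < p := by linarith
  unfold Wp
  rw [one_div, ENNReal.le_rpow_inv_iff hp0, ENNReal.ofReal_rpow_of_pos hε]
  refine le_iInf₂ fun π hπ => le_trans ?_ (cost_lower p hp J hJ a b r hr j0 hj π hπ)
  have h2 : 1 ≤ 2 ^ J - 1 := by
    have : 2 ^ 1 ≤ 2 ^ J := Nat.pow_le_pow_right (by norm_num) hJ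
    omega
  rw [← div_eq_mul_inv, ENNReal.le_div_iff_mul_le
    (Or.inl (by have : 2 ^ J - 1 ≠ 0 := by omega
                exact_mod_cast this)) (Or.inl (ENNReal.natCast_ne_top _)),
    ← ENNReal.ofReal_natCast, ← ENNReal.ofReal_mul (by positivity)]
  apply ENNReal.ofReal_le_ofReal
  refine le_trans ?_ hεr
  gcongr
  have : ((2 ^ J - 1 : ℕ) : ℝ) ≤ ((2 ^ J : ℕ) : ℝ) := by exact_mod_cast Nat.sub_le _ _
  simpa using this

lemma Wp_self {X : Type*} [MetricSpace X] [CompactSpace X] [MeasurableSpace X] [BorelSpace X]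
    (p : ℝ) (hp : 1 ≤ p) (μ : Measure X) : Wp p μ μ = 0 := by
  have hp0 : 0 < p := by linarith
  unfold Wp
  have hm : Measurable (fun x : X => (x, x)) := by fun_prop
  have h0 : (⨅ (π : Measure (X × X)) (_ : IsCoupling μ μ π),
    ∫⁻ z, ENNReal.ofReal (dist z.1 z.2 ^ p) ∂π) = 0 := by
    rw [← nonpos_iff_eq_zero]
    refine iInf₂_le_of_le (μ.map (fun x => (x, x))) ⟨?_, ?_⟩ ?_
    · rw [Measure.map_map measurable_fst hm]; exact Measure.map_id
    · rw [Measure.map_map measurable_snd hm]; exact Measure.map_id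
    · rw [lintegral_map (by fun_prop) hm]
      simp [Real.zero_rpow hp0.ne']
  rw [h0, ENNReal.zero_rpow_of_pos (by positivity)]

lemma exists_matrix {ι : Type*} [Fintype ι] [DecidableEq ι] (a b : ι → NNReal)
    (h : ∑ j, a j = ∑ j, b j) : ∃ m : ι → ι → NNReal, (∀ j, ∑ l, m j l = a j) ∧
      (∀ l, ∑ j, m j l = b l) ∧
      ∑ j, ∑ l, (if j = l then 0 else m j l) ≤ ∑ j, (a j - b j) := by
  have hR : ∑ j, (a j - b j) = ∑ j, (b j - a j) := by
    have h1 : ∑ j, (a j - b j) + ∑ j, min (a j) (b j) = ∑ j, (b j - a j) + ∑ j, min (a j) (b j) := by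
      rw [← Finset.sum_add_distrib, ← Finset.sum_add_distrib]
      simp only [tsub_add_min]
      rw [h]
      refine Finset.sum_congr rfl fun j _ => ?_
      rw [min_comm, tsub_add_min]
    exact add_right_cancel h1
  set R := ∑ j, (a j - b j) with hRdef
  have hz : ∀ x : NNReal, x ≤ R → x * R / R = x := by
    intro x hx
    by_cases h0 : R = 0
    · have : x = 0 := le_antisymm (h0 ▸ hx) (zero_le)
      simp [this]
    · field_simp
  refine ⟨fun j l => (if j = l then min (a j) (b j) else 0) + (a j - b j) * (b l - a l) / R,
    fun j => ?_, fun l => ?_, ?_⟩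
  · rw [Finset.sum_add_distrib, ← Finset.sum_div, ← Finset.mul_sum, ← hR, hz]
    · simp only [Finset.sum_ite_eq, Finset.mem_univ, if_true]
      rw [add_comm, tsub_add_min]
    · exact Finset.single_le_sum (f := fun j => a j - b j) (fun _ _ => zero_le) (Finset.mem_univ j)
  · rw [Finset.sum_add_distrib, ← Finset.sum_div, ← Finset.sum_mul, ← hRdef, mul_comm R, hz]
    · simp only [Finset.sum_ite_eq', Finset.mem_univ, if_true]
      rw [add_comm, min_comm, tsub_add_min]
    · rw [hR]
      exact Finset.single_le_sum (f := fun j => b j - a j) (fun _ _ => zero_le) (Finset.mem_univ l)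
  · calc _ ≤ ∑ j, ∑ l, (a j - b j) * (b l - a l) / R := by
          refine Finset.sum_le_sum fun j _ => Finset.sum_le_sum fun l _ => ?_
          by_cases hjl : j = l <;> simp [hjl]
      _ = ∑ j, (a j - b j) * R / R := by
          refine Finset.sum_congr rfl fun j _ => ?_
          rw [← Finset.sum_div, ← Finset.mul_sum, ← hR]
      _ ≤ R := by
          refine Finset.sum_le_sum fun j _ => ?_
          rw [hz]
          exact Finset.single_le_sum (f := fun j => a j - b j) (fun _ _ => zero_le)
            (Finset.mem_univ j)

lemma sum_fiber {X ι : Type*} [MeasurableSpace X] [Fintype ι] [MeasurableSpace ι]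
    [MeasurableSingletonClass ι] (g : X → ι) (hg : Measurable g) (μ : Measure X) (s : Set X) :
    ∑ j, μ (s ∩ g ⁻¹' {j}) = μ s := by
  have := sum_measure_preimage_singleton (μ := μ.restrict s) Finset.univ (f := g)
    (fun y _ => hg (measurableSet_singleton y))
  simp only [Finset.coe_univ, Set.preimage_univ, Measure.restrict_apply_univ] at this
  rw [← this]
  refine Finset.sum_congr rfl fun j _ => ?_
  rw [Measure.restrict_apply (hg (measurableSet_singleton j)), Set.inter_comm]

lemma coef_aux {ι : Type*} [Fintype ι] (f c : ι → NNReal) (A : NNReal)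
    (hA : ∑ l, f l = A) (hc : ∀ l, c l = 0 → f l = 0) (M : ℝ≥0∞) (hM : M ≤ A) :
    ∑ l, ((f l / (A * c l) : NNReal) : ℝ≥0∞) * (M * (c l : ℝ≥0∞)) = M := by
  have h1 : ∀ l, ((f l / (A * c l) : NNReal) : ℝ≥0∞) * (M * (c l : ℝ≥0∞)) =
      ((f l / A : NNReal) : ℝ≥0∞) * M := by
    intro l
    rw [mul_comm M, ← mul_assoc, ← ENNReal.coe_mul]
    congr 2
    by_cases h0 : c l = 0
    · simp [h0, hc l h0]
    · field_simp
  simp only [h1]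
  rw [← Finset.sum_mul, ← ENNReal.ofNNReal_finsetSum, ← Finset.sum_div, hA]
  by_cases h0 : A = 0
  · have : M = 0 := by simpa [h0] using hM
    simp [this]
  · simp [div_self h0]

lemma exists_coupling {X ι : Type*} [MeasurableSpace X] [Fintype ι] [DecidableEq ι]
    [MeasurableSpace ι] [MeasurableSingletonClass ι] (g : X → ι) (hg : Measurable g)
    (μ ν : Measure X) [IsProbabilityMeasure μ] [IsProbabilityMeasure ν]
    (a b : ι → NNReal) (ha : ∀ j, μ (g ⁻¹' {j}) = a j) (hb : ∀ j, ν (g ⁻¹' {j}) = b j) :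
    ∃ π : Measure (X × X), IsCoupling μ ν π ∧
      π {z | g z.1 ≠ g z.2} ≤ ((∑ j, (a j - b j) : NNReal) : ℝ≥0∞) := by
  have hsum : ∑ j, a j = ∑ j, b j := by
    have h1 := sum_fiber g hg μ Set.univ
    have h2 := sum_fiber g hg ν Set.univ
    simp only [Set.univ_inter, ha, hb, measure_univ] at h1 h2
    rw [← ENNReal.coe_inj, ENNReal.ofNNReal_finsetSum, ENNReal.ofNNReal_finsetSum, h1, h2]
  obtain ⟨m, hm1, hm2, hm3⟩ := exists_matrix a b hsum
  have hma : ∀ j l, a j = 0 → m j l = 0 := by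
    intro j l h0
    have := hm1 j
    rw [h0, Finset.sum_eq_zero_iff] at this
    exact this l (Finset.mem_univ l)
  have hmb : ∀ j l, b l = 0 → m j l = 0 := by
    intro j l h0
    have := hm2 l
    rw [h0, Finset.sum_eq_zero_iff] at this
    exact this j (Finset.mem_univ j)
  have hgm : ∀ j, MeasurableSet (g ⁻¹' {j}) := fun j => hg (measurableSet_singleton j)
  set π : Measure (X × X) := ∑ j, ∑ l, ((m j l / (a j * b l) : NNReal) : ℝ≥0∞) •
    (μ.restrict (g ⁻¹' {j})).prod (ν.restrict (g ⁻¹' {l})) with hπ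
  have happ : ∀ s t : Set X, MeasurableSet s → MeasurableSet t → π (s ×ˢ t) =
      ∑ j, ∑ l, ((m j l / (a j * b l) : NNReal) : ℝ≥0∞) *
        (μ (s ∩ g ⁻¹' {j}) * ν (t ∩ g ⁻¹' {l})) := by
    intro s t hs ht
    simp only [hπ, Measure.finsetSum_apply, Measure.smul_apply, smul_eq_mul, Measure.prod_prod,
      Measure.restrict_apply hs, Measure.restrict_apply ht]
  refine ⟨π, ⟨?_, ?_⟩, ?_⟩
  · ext s hs
    rw [Measure.map_apply measurable_fst hs, ← Set.prod_univ, happ _ _ hs MeasurableSet.univ,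
      ← sum_fiber g hg μ s]
    refine Finset.sum_congr rfl fun j _ => ?_
    simp only [Set.univ_inter, hb]
    exact coef_aux (m j) b (a j) (hm1 j) (hmb j) _
      ((measure_mono Set.inter_subset_right).trans_eq (ha j))
  · ext s hs
    rw [Measure.map_apply measurable_snd hs, ← Set.univ_prod, happ _ _ MeasurableSet.univ hs,
      ← sum_fiber g hg ν s, Finset.sum_comm]
    refine Finset.sum_congr rfl fun l _ => ?_
    simp only [Set.univ_inter, ha]
    refine Eq.trans ?_ (coef_aux (fun j => m j l) a (b l) (hm2 l) (fun j => hma j l)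
      (ν (s ∩ g ⁻¹' {l})) ((measure_mono Set.inter_subset_right).trans_eq (hb l)))
    refine Finset.sum_congr rfl fun j _ => ?_
    rw [mul_comm (a j), mul_comm (a j : ℝ≥0∞)]
  · have hE : {z : X × X | g z.1 ≠ g z.2} ⊆
        ⋃ q ∈ (Finset.univ.filter fun q : ι × ι => q.1 ≠ q.2),
          (g ⁻¹' {q.1}) ×ˢ (g ⁻¹' {q.2}) := by
      rintro ⟨x, y⟩ hxy
      simp only [Set.mem_iUnion]
      exact ⟨(g x, g y), by simpa using hxy, by simp⟩
    have hval : ∀ j l, π ((g ⁻¹' {j}) ×ˢ (g ⁻¹' {l})) ≤ (m j l : ℝ≥0∞) := by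
      intro j l
      rw [happ _ _ (hgm j) (hgm l), Finset.sum_eq_single j, Finset.sum_eq_single l]
      · rw [Set.inter_self, Set.inter_self, ha, hb, ← ENNReal.coe_mul, ← ENNReal.coe_mul]
        apply ENNReal.coe_le_coe.mpr
        by_cases h0 : a j * b l = 0
        · simp [h0]
        · rw [div_mul_cancel₀ _ h0]
      · intro l' _ hl
        have : g ⁻¹' {l} ∩ g ⁻¹' {l'} = ∅ := by
          ext x; simp only [Set.mem_inter_iff, Set.mem_preimage, Set.mem_singleton_iff,
            Set.mem_empty_iff_false, iff_false]; rintro ⟨h1, h2⟩; exact hl (h2.symm.trans h1)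
        simp [this]
      · simp
      · intro j' _ hj
        have : g ⁻¹' {j} ∩ g ⁻¹' {j'} = ∅ := by
          ext x; simp only [Set.mem_inter_iff, Set.mem_preimage, Set.mem_singleton_iff,
            Set.mem_empty_iff_false, iff_false]; rintro ⟨h1, h2⟩; exact hj (h2.symm.trans h1)
        simp [this]
      · simp
    refine (measure_mono hE).trans ((measure_biUnion_finset_le _ _).trans ?_)
    refine le_trans (Finset.sum_le_sum fun q _ => hval q.1 q.2) ?_
    rw [← ENNReal.ofNNReal_finsetSum]
    apply ENNReal.coe_le_coe.mpr
    refine le_trans (le_of_eq ?_) hm3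
    rw [Finset.sum_filter, ← Finset.univ_product_univ, Finset.sum_product]
    refine Finset.sum_congr rfl fun j _ => Finset.sum_congr rfl fun l _ => ?_
    by_cases h : j = l <;> simp [h]

lemma exists_partition {X : Type*} [MetricSpace X] [CompactSpace X] [MeasurableSpace X]
    [BorelSpace X] (δ : ℝ) (hδ : 0 < δ) :
    ∃ (k : ℕ) (g : X → Fin k), Measurable g ∧ ∀ x y, g x = g y → dist x y < δ := by
  rcases isEmpty_or_nonempty X with hX | hX
  · exact ⟨0, fun x => isEmptyElim x, measurable_of_empty _, fun x => isEmptyElim x⟩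
  · have hcov : (Set.univ : Set X) ⊆ ⋃ k, Metric.ball (TopologicalSpace.denseSeq X k) (δ / 2) := by
      intro x _
      obtain ⟨k, hk⟩ := (TopologicalSpace.denseRange_denseSeq X).exists_dist_lt x
        (half_pos hδ)
      exact Set.mem_iUnion.mpr ⟨k, hk⟩
    obtain ⟨t, ht⟩ := isCompact_univ.elim_finite_subcover _ (fun k => Metric.isOpen_ball) hcov
    set N := t.sup id
    set e := TopologicalSpace.denseSeq X
    have hnear : ∀ x, dist (SimpleFunc.nearestPt e N x) x < δ / 2 := by
      intro x
      have := ht (Set.mem_univ x)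
      simp only [Set.mem_iUnion] at this
      obtain ⟨k, hk, hx⟩ := this
      have h1 := SimpleFunc.edist_nearestPt_le e x (Finset.le_sup (f := id) hk : k ≤ N)
      rw [edist_dist, edist_dist, ENNReal.ofReal_le_ofReal_iff dist_nonneg] at h1
      rw [Metric.mem_ball, dist_comm] at hx
      exact h1.trans_lt hx
    refine ⟨N + 1, fun x => ⟨SimpleFunc.nearestPtInd e N x,
      Nat.lt_succ_of_le (SimpleFunc.nearestPtInd_le e N x)⟩, ?_, ?_⟩
    · apply measurable_to_countable'
      intro y
      convert (SimpleFunc.nearestPtInd e N).measurableSet_fiber y.val using 1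
      ext x
      simp [Fin.ext_iff]
    · intro x y hxy
      have h2 : SimpleFunc.nearestPt e N x = SimpleFunc.nearestPt e N y := by
        simp only [Fin.mk.injEq] at hxy
        simp [SimpleFunc.nearestPt, hxy]
      have h3 := hnear x
      have h4 := hnear y
      rw [h2] at h3
      have := dist_triangle_left x y (SimpleFunc.nearestPt e N y)
      linarith

lemma Wp_upper {X ι : Type*} [MetricSpace X] [CompactSpace X] [MeasurableSpace X] [BorelSpace X]
    [Countable ι] [MeasurableSpace ι] [MeasurableSingletonClass ι]
    (p : ℝ) (hp : 1 ≤ p) (f : X → X) (hf : Measurable f) (g : X → ι) (hg : Measurable g)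
    (η D q : ℝ) (hη : 0 ≤ η) (hq : 0 ≤ q) (hD0 : 0 ≤ D)
    (hgη : ∀ x y, g x = g y → dist (f x) (f y) ≤ η) (hD : ∀ x y : X, dist x y ≤ D)
    (μ ν : Measure X) [IsProbabilityMeasure μ] (π : Measure (X × X)) (hπ : IsCoupling μ ν π)
    (hπq : π {z | g z.1 ≠ g z.2} ≤ ENNReal.ofReal q) (ε : ℝ) (hε : 0 < ε)
    (hlt : η ^ p + D ^ p * q < ε ^ p) :
    Wp p (μ.map f) (ν.map f) < ENNReal.ofReal ε := by
  have hp0 : 0 < p := by linarith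
  have hff : Measurable (Prod.map f f) := hf.prodMap hf
  unfold Wp
  rw [one_div, ENNReal.rpow_inv_lt_iff hp0, ENNReal.ofReal_rpow_of_pos hε]
  have hc : IsCoupling (μ.map f) (ν.map f) (π.map (Prod.map f f)) := by
    obtain ⟨h1, h2⟩ := hπ
    constructor
    · rw [Measure.map_map measurable_fst hff, ← h1, Measure.map_map hf measurable_fst]; rfl
    · rw [Measure.map_map measurable_snd hff, ← h2, Measure.map_map hf measurable_snd]; rfl
  have hu : π Set.univ = 1 := by
    have := hπ.1
    rw [← Set.preimage_univ (f := Prod.fst), ← Measure.map_apply measurable_fst MeasurableSet.univ,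
      this, measure_univ]
  refine lt_of_le_of_lt (iInf₂_le _ hc) ?_
  rw [lintegral_map (by fun_prop) hff]
  set E : Set (X × X) := {z | g z.1 ≠ g z.2} with hE
  have hEm : MeasurableSet E := by
    have : MeasurableSet {z : X × X | g z.1 = g z.2} :=
      measurableSet_eq_fun (hg.comp measurable_fst) (hg.comp measurable_snd)
    exact this.compl
  calc ∫⁻ z, ENNReal.ofReal (dist (Prod.map f f z).1 (Prod.map f f z).2 ^ p) ∂π
      ≤ ∫⁻ z, (ENNReal.ofReal (η ^ p) + E.indicator (fun _ => ENNReal.ofReal (D ^ p)) z) ∂π := by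
        apply lintegral_mono
        rintro ⟨x, y⟩
        by_cases hxy : g x = g y
        · refine le_trans ?_ le_self_add
          exact ENNReal.ofReal_le_ofReal (Real.rpow_le_rpow dist_nonneg (hgη x y hxy) hp0.le)
        · refine le_trans ?_ le_add_self
          rw [Set.indicator_of_mem (by exact hxy)]
          exact ENNReal.ofReal_le_ofReal (Real.rpow_le_rpow dist_nonneg (hD _ _) hp0.le)
    _ = ENNReal.ofReal (η ^ p) + ENNReal.ofReal (D ^ p) * π E := by
        rw [lintegral_add_left measurable_const, lintegral_const, hu, mul_one,
          lintegral_indicator_const hEm]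
    _ ≤ ENNReal.ofReal (η ^ p) + ENNReal.ofReal (D ^ p) * ENNReal.ofReal q := by gcongr
    _ = ENNReal.ofReal (η ^ p + D ^ p * q) := by
        rw [← ENNReal.ofReal_mul (by positivity), ENNReal.ofReal_add (by positivity) (by positivity)]
    _ < _ := by
        rw [ENNReal.ofReal_lt_ofReal_iff (by positivity)]; exact hlt

lemma iter_map {X : Type*} [MetricSpace X] [MeasurableSpace X] [BorelSpace X]
    (φ : X → X) (hφ : Continuous φ) (i : ℕ) (μ : ProbabilityMeasure X) :
    (((fun μ : ProbabilityMeasure X => μ.map (f := φ) hφ.measurable.aemeasurable)^[i] μ :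
      ProbabilityMeasure X) : Measure X) = (μ : Measure X).map (φ^[i]) := by
  induction i with
  | zero => simp
  | succ i ih =>
    rw [Function.iterate_succ_apply', ProbabilityMeasure.toMeasure_map, ih,
      Measure.map_map hφ.measurable (hφ.iterate i).measurable, Function.iterate_succ']

lemma exists_delta {X : Type*} [MetricSpace X] [CompactSpace X] (φ : X → X) (hφ : Continuous φ)
    (n : ℕ) (η : ℝ) (hη : 0 < η) :
    ∃ δ > 0, ∀ x y, dist x y < δ → ∀ i ≤ n, dist (φ^[i] x) (φ^[i] y) < η := by
  have hc : Continuous (fun x => fun i : Fin (n + 1) => φ^[i.val] x) :=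
    continuous_pi fun i => hφ.iterate i
  obtain ⟨δ, hδ, h⟩ := Metric.uniformContinuous_iff.mp
    (CompactSpace.uniformContinuous_of_continuous hc) η hη
  refine ⟨δ, hδ, fun x y hxy i hi => ?_⟩
  exact lt_of_le_of_lt (dist_le_pi_dist (fun i : Fin (n + 1) => φ^[i.val] x)
    (fun i : Fin (n + 1) => φ^[i.val] y) ⟨i, Nat.lt_succ_of_le hi⟩) (h hxy)

lemma floor_close (N : ℕ) (hN : 0 < N) (a b : NNReal) (h : ⌊N * a⌋₊ = ⌊N * b⌋₊) :
    a - b ≤ 1 / N := by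
  rw [tsub_le_iff_right]
  have h1 := Nat.lt_floor_add_one (N * a)
  have h2 := Nat.floor_le (zero_le : 0 ≤ N * b)
  rw [h] at h1
  have hN' : (0 : NNReal) < N := by exact_mod_cast hN
  have h3 : (N : NNReal) * a ≤ N * b + 1 := by
    calc _ ≤ _ := h1.le
      _ ≤ _ := by gcongr
  have h4 : 1 / (N : NNReal) + b = (N * b + 1) / N := by
    field_simp
    ring
  rw [h4, le_div_iff₀ hN', mul_comm]
  exact h3

lemma sep_bdd {X : Type*} [MetricSpace X] [CompactSpace X] [MeasurableSpace X] [BorelSpace X]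
    (p : ℝ) (hp : 1 ≤ p) (φ : X → X) (hφ : Continuous φ) (ε : ℝ) (hε : 0 < ε) (n : ℕ) :
    BddAbove {m | ∃ S : Finset (ProbabilityMeasure X), S.card = m ∧ ∀ x ∈ S, ∀ y ∈ S, x ≠ y →
      ∃ i ≤ n, ENNReal.ofReal ε ≤
        (fun μ ν : ProbabilityMeasure X => Wp p (μ : Measure X) (ν : Measure X))
        ((fun μ : ProbabilityMeasure X => μ.map (f := φ) hφ.measurable.aemeasurable)^[i] x)
        ((fun μ : ProbabilityMeasure X => μ.map (f := φ) hφ.measurable.aemeasurable)^[i] y)} := by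
  have hp0 : 0 < p := by linarith
  have hεp : 0 < ε ^ p := by positivity
  obtain ⟨δ, hδ, hδ'⟩ := exists_delta φ hφ n (ε / 4) (by positivity)
  obtain ⟨k, g, hg, hgδ⟩ := exists_partition (X := X) δ hδ
  set D := Metric.diam (Set.univ : Set X) with hDdef
  have hD0 : 0 ≤ D := Metric.diam_nonneg
  have hD : ∀ x y : X, dist x y ≤ D := fun x y =>
    Metric.dist_le_diam_of_mem isCompact_univ.isBounded (Set.mem_univ x) (Set.mem_univ y)
  obtain ⟨N, hN⟩ := exists_nat_gt (4 * (D ^ p * k) / ε ^ p)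
  have hN0 : (0 : ℝ) < N := lt_of_le_of_lt (by positivity) hN
  have hN1 : 0 < N := by exact_mod_cast hN0
  have hηp : (ε / 4) ^ p ≤ ε ^ p / 4 := by
    rw [Real.div_rpow hε.le (by norm_num)]
    have : (4 : ℝ) ≤ 4 ^ p := by
      simpa using Real.rpow_le_rpow_of_exponent_le (by norm_num : (1:ℝ) ≤ 4) hp
    gcongr
  have hq : D ^ p * (k / N) ≤ ε ^ p / 4 := by
    rw [div_lt_iff₀ hεp] at hN
    rw [← mul_div_assoc, div_le_iff₀ hN0]
    linarith
  have hle1 : ∀ (μ : ProbabilityMeasure X) (A : Set X), ⌊(N : NNReal) * μ A⌋₊ < N + 1 := by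
    intro μ A
    apply Nat.lt_succ_of_le
    have h1 : (N : NNReal) * μ A ≤ N := by
      calc (N : NNReal) * μ A ≤ N * 1 := by gcongr; exact μ.apply_le_one A
        _ = N := mul_one _
    calc _ ≤ ⌊(N : NNReal)⌋₊ := Nat.floor_le_floor h1
      _ = N := Nat.floor_natCast N
  let F : ProbabilityMeasure X → (Fin k → Fin (N + 1)) := fun μ j =>
    ⟨⌊(N : NNReal) * μ (g ⁻¹' {j})⌋₊, hle1 μ _⟩
  refine ⟨Fintype.card (Fin k → Fin (N + 1)), ?_⟩
  rintro m ⟨S, rfl, hS⟩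
  rw [← Finset.card_univ]
  refine Finset.card_le_card_of_injOn F (fun _ _ => Finset.mem_univ _) ?_
  intro μ hμ ν hν hF
  by_contra hne
  obtain ⟨i, hi, hle⟩ := hS μ hμ ν hν hne
  obtain ⟨π, hπ, hπq⟩ := exists_coupling g hg (μ : Measure X) (ν : Measure X)
    (fun j => μ (g ⁻¹' {j})) (fun j => ν (g ⁻¹' {j}))
    (fun j => (ProbabilityMeasure.ennreal_coeFn_eq_coeFn_toMeasure μ _).symm)
    (fun j => (ProbabilityMeasure.ennreal_coeFn_eq_coeFn_toMeasure ν _).symm)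
  have hsum : (∑ j, (μ (g ⁻¹' {j}) - ν (g ⁻¹' {j})) : NNReal) ≤ k / N := by
    calc _ ≤ ∑ j : Fin k, 1 / (N : NNReal) := by
          refine Finset.sum_le_sum fun j _ => floor_close N hN1 _ _ ?_
          have := congrFun hF j
          simpa [F] using this
      _ = k / N := by simp [div_eq_mul_inv]
  have hπq' : π {z | g z.1 ≠ g z.2} ≤ ENNReal.ofReal (k / N) := by
    refine hπq.trans ?_
    rw [ENNReal.ofReal, ENNReal.coe_le_coe]
    refine hsum.trans (le_of_eq ?_)
    rw [Real.toNNReal_div (by positivity)]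
    simp
  have := Wp_upper p hp (φ^[i]) (hφ.iterate i).measurable g hg (ε / 4) D (k / N) (by positivity)
    (by positivity) hD0 (fun x y hxy => (hδ' x y (hgδ x y hxy) i hi).le) hD
    (μ : Measure X) (ν : Measure X) π hπ hπq' ε hε (by linarith)
  rw [← iter_map φ hφ i μ, ← iter_map φ hφ i ν] at this
  exact absurd hle (not_le.mpr this)

lemma exists_sep {Y : Type*} (ρ : Y → Y → ℝ≥0∞) (ψ : Y → Y) (ε : ℝ) (n : ℕ) :
    ∃ S : Finset Y, S.card = sepCount ρ ψ ε n ∧ ∀ x ∈ S, ∀ y ∈ S, x ≠ y →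
    ∃ i ≤ n, ENNReal.ofReal ε ≤ ρ (ψ^[i] x) (ψ^[i] y) := by
  by_cases hb : BddAbove {m | ∃ S : Finset Y, S.card = m ∧ ∀ x ∈ S, ∀ y ∈ S, x ≠ y →
    ∃ i ≤ n, ENNReal.ofReal ε ≤ ρ (ψ^[i] x) (ψ^[i] y)}
  · have hne : {m | ∃ S : Finset Y, S.card = m ∧ ∀ x ∈ S, ∀ y ∈ S, x ≠ y →
      ∃ i ≤ n, ENNReal.ofReal ε ≤ ρ (ψ^[i] x) (ψ^[i] y)}.Nonempty := ⟨0, ∅, by simp⟩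
    exact Nat.sSup_mem hne hb
  · refine ⟨∅, ?_, by simp⟩
    unfold sepCount
    rw [Nat.sSup_of_not_bddAbove hb]
    rfl

lemma sepCount_pow_le {X : Type*} [MetricSpace X] [CompactSpace X] [MeasurableSpace X]
    [BorelSpace X] (p : ℝ) (hp : 1 ≤ p) (φ : X → X) (hφ : Continuous φ) (ε ε0 : ℝ) (hε : 0 < ε)
    (hε0 : 0 < ε0) (n J : ℕ) (hJ : 1 ≤ J) (h : ε ^ p * 2 ^ J ≤ (ε0 / (2 * J + 1)) ^ p) :
    sepCount (fun x y => ENNReal.ofReal (dist x y)) φ ε0 n ^ J ≤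
      sepCount (fun μ ν : ProbabilityMeasure X => Wp p (μ : Measure X) (ν : Measure X))
        (fun μ => μ.map (f := φ) hφ.measurable.aemeasurable) ε n := by
  classical
  obtain ⟨S, hS, hsep⟩ := exists_sep (fun x y : X => ENNReal.ofReal (dist x y)) φ ε0 n
  let G : (Fin J → X) → ProbabilityMeasure X := fun a => ⟨atm J a, atm_prob J hJ a⟩
  have key : ∀ a ∈ Fintype.piFinset (fun _ : Fin J => S), ∀ b ∈ Fintype.piFinset (fun _ : Fin J => S),
      a ≠ b → ∃ i ≤ n, ENNReal.ofReal ε ≤ Wp p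
        (((fun μ : ProbabilityMeasure X => μ.map (f := φ) hφ.measurable.aemeasurable)^[i] (G a) :
          ProbabilityMeasure X) : Measure X)
        (((fun μ : ProbabilityMeasure X => μ.map (f := φ) hφ.measurable.aemeasurable)^[i] (G b) :
          ProbabilityMeasure X) : Measure X) := by
    intro a ha b hb hab
    obtain ⟨j, hj⟩ := Function.ne_iff.mp hab
    obtain ⟨i, hi, hd⟩ := hsep _ (Fintype.mem_piFinset.mp ha j) _ (Fintype.mem_piFinset.mp hb j) hj
    refine ⟨i, hi, ?_⟩
    rw [iter_map φ hφ, iter_map φ hφ]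
    change _ ≤ Wp p ((atm J a).map _) ((atm J b).map _)
    rw [atm_map _ _ _ (hφ.iterate i).measurable, atm_map _ _ _ (hφ.iterate i).measurable]
    refine Wp_lower p hp J hJ _ _ (ε0 / (2 * J + 1)) (by positivity) j ?_ ε hε h
    rw [ENNReal.ofReal_le_ofReal_iff dist_nonneg] at hd
    rw [mul_div_cancel₀ _ (by positivity)]
    exact hd
  have hinj : Set.InjOn G (Fintype.piFinset (fun _ : Fin J => S)) := by
    intro a ha b hb hab
    by_contra hne
    obtain ⟨i, _, hi⟩ := key a ha b hb hne
    rw [hab, Wp_self p hp] at hi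
    simp only [nonpos_iff_eq_zero, ENNReal.ofReal_eq_zero] at hi
    linarith
  apply le_csSup (sep_bdd p hp φ hφ ε hε n)
  refine ⟨(Fintype.piFinset (fun _ : Fin J => S)).image G, ?_, ?_⟩
  · rw [Finset.card_image_of_injOn hinj, Fintype.card_piFinset]
    simp [hS]
  · intro x hx y hy hxy
    obtain ⟨a, ha, rfl⟩ := Finset.mem_image.mp hx
    obtain ⟨b, hb, rfl⟩ := Finset.mem_image.mp hy
    exact key a ha b hb (fun h => hxy (by rw [h]))

lemma exists_J (p : ℝ) (hp : 1 ≤ p) (ε0 : ℝ) (hε0 : 0 < ε0) (c : ℝ) (hc : 0 < c)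
    (hcp : c < p / Real.log 2) :
    ∀ᶠ ε : ℝ in 𝓝[>] (0:ℝ), 0 < ε ∧ ε < 1 ∧ ∃ J : ℕ, 1 ≤ J ∧ c * |Real.log ε| ≤ J ∧
      ε ^ p * 2 ^ J ≤ (ε0 / (2 * J + 1)) ^ p := by
  have hp0 : 0 < p := by linarith
  have hl2 : 0 < Real.log 2 := Real.log_pos (by norm_num)
  have hd : 0 < p - c * Real.log 2 := by
    rw [lt_div_iff₀ hl2] at hcp; linarith
  set d := p - c * Real.log 2 with hddef
  -- the needed inequality, as a function of L = - log ε
  have hev : ∀ᶠ L : ℝ in atTop, Real.log 2 + p * (Real.log (2 * c * L + 3) - Real.log ε0) ≤ d * L := by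
    have ho : (fun L : ℝ => Real.log (2 * c * L + 3)) =o[atTop] fun L : ℝ => 2 * c * L + 3 :=
      Real.isLittleO_log_id_atTop.comp_tendsto
        (tendsto_atTop_add_const_right _ _ (tendsto_id.const_mul_atTop (by positivity)))
    have h1 := ho.bound (show (0:ℝ) < d / (4 * p * c) by positivity)
    have h2 : Tendsto (fun L : ℝ => d * L / 2) atTop atTop := by
      have := (tendsto_id (α := ℝ) (x := atTop)).const_mul_atTop (show 0 < d / 2 by positivity)
      refine this.congr fun L => ?_
      simp only [id]; ring
    filter_upwards [h1, h2.eventually_ge_atTop (Real.log 2 + p * (3 * d / (4 * p * c) - Real.log ε0)),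
      eventually_ge_atTop 0] with L hL1 hL2 hL0
    rw [Real.norm_eq_abs, Real.norm_eq_abs, abs_of_nonneg (a := 2 * c * L + 3) (by positivity)] at hL1
    have h3 := (le_abs_self _).trans hL1
    have h4 : p * Real.log (2 * c * L + 3) ≤ p * (d / (4 * p * c) * (2 * c * L + 3)) := by gcongr
    have h5 : p * (d / (4 * p * c) * (2 * c * L + 3)) = d * L / 2 + p * (3 * d / (4 * p * c)) := by
      field_simp
      ring
    linarith
  have hlog : Tendsto (fun ε : ℝ => - Real.log ε) (𝓝[>] 0) atTop :=
    tendsto_neg_atBot_atTop.comp Real.tendsto_log_nhdsGT_zero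
  filter_upwards [hlog.eventually hev, hlog.eventually_gt_atTop 0, self_mem_nhdsWithin]
    with ε h1 h2 h3
  have hε : 0 < ε := h3
  have hε1 : ε < 1 := by
    by_contra hcon
    have := Real.log_nonneg (not_lt.mp hcon)
    linarith
  set L := - Real.log ε with hL
  have habs : |Real.log ε| = L := by rw [abs_of_neg (by linarith)]
  refine ⟨hε, hε1, ⌈c * L⌉₊, Nat.ceil_pos.mpr (by positivity), ?_, ?_⟩
  · rw [habs]; exact Nat.le_ceil _
  · have hJ : (⌈c * L⌉₊ : ℝ) ≤ c * L + 1 := (Nat.ceil_lt_add_one (by positivity)).le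
    set J := ⌈c * L⌉₊
    rw [← Real.log_le_log_iff (by positivity) (by positivity),
      Real.log_mul (by positivity) (by positivity), Real.log_rpow hε, Real.log_pow,
      Real.log_rpow (by positivity), Real.log_div (by positivity) (by positivity)]
    have h5 : Real.log (2 * J + 1) ≤ Real.log (2 * c * L + 3) := by
      apply Real.log_le_log (by positivity)
      linarith
    have h6 : (J : ℝ) * Real.log 2 ≤ (c * L + 1) * Real.log 2 := by gcongr
    have h7 : p * Real.log (2 * J + 1) ≤ p * Real.log (2 * c * L + 3) := by gcongr
    have h8 : Real.log ε = - L := by rw [hL]; ring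
    rw [h8]
    have h9 : d * L = p * L - c * L * Real.log 2 := by rw [hddef]; ring
    linarith

/-- if `φ` has positive topological entropy then the push-forward
map on `W_p(X)` has metric mean dimension at least `p · h_top(φ) / log 2`. -/
theorem stmt11 {X : Type*} [MetricSpace X] [CompactSpace X]
    [MeasurableSpace X] [BorelSpace X]
    (p : ℝ) (hp : 1 ≤ p) (φ : X → X) (hφ : Continuous φ)
    (hpos : 0 < htop φ) :
    ENNReal.ofReal p * htop φ / ENNReal.ofReal (Real.log 2) ≤
      mdimM (fun μ ν : ProbabilityMeasure X => Wp p (μ : Measure X) (ν : Measure X))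
        (fun μ => μ.map (f := φ) hφ.measurable.aemeasurable) := by
  have hp0 : 0 < p := by linarith
  have hl2 : 0 < Real.log 2 := Real.log_pos (by norm_num)
  have main : ∀ ε0 : ℝ, 0 < ε0 → ENNReal.ofReal (p / Real.log 2) * Filter.limsup (fun n : ℕ =>
      ENNReal.ofReal
        (Real.log (sepCount (fun x y => ENNReal.ofReal (dist x y)) φ ε0 n) / n))
      Filter.atTop ≤ mdimM (fun μ ν : ProbabilityMeasure X => Wp p (μ : Measure X) (ν : Measure X))
        (fun μ => μ.map (f := φ) hφ.measurable.aemeasurable) := by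
    intro ε0 hε0
    set H := Filter.limsup (fun n : ℕ =>
      ENNReal.ofReal
        (Real.log (sepCount (fun x y => ENNReal.ofReal (dist x y)) φ ε0 n) / n))
      Filter.atTop with hH
    have hlow : ∀ c : ℝ, 0 < c → c < p / Real.log 2 → ENNReal.ofReal c * H ≤
        mdimM (fun μ ν : ProbabilityMeasure X => Wp p (μ : Measure X) (ν : Measure X))
        (fun μ => μ.map (f := φ) hφ.measurable.aemeasurable) := by
      intro c hc hcp
      unfold mdimM
      refine Filter.le_liminf_of_le (by isBoundedDefault) ?_
      filter_upwards [exists_J p hp ε0 hε0 c hc hcp] with ε hε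
      obtain ⟨hε, hε1, J, hJ, hcJ, hεJ⟩ := hε
      have hL : 0 < |Real.log ε| := abs_pos.mpr (Real.log_neg hε hε1).ne
      rw [hH, ← ENNReal.limsup_const_mul_of_ne_top ENNReal.ofReal_ne_top]
      refine Filter.limsup_le_limsup (Eventually.of_forall fun n => ?_)
        (by isBoundedDefault) (by isBoundedDefault)
      simp only
      rw [← ENNReal.ofReal_mul hc.le]
      apply ENNReal.ofReal_le_ofReal
      have hpow := sepCount_pow_le p hp φ hφ ε ε0 hε hε0 n J hJ hεJ
      set s := sepCount (fun x y => ENNReal.ofReal (dist x y)) φ ε0 n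
      set t := sepCount (fun μ ν : ProbabilityMeasure X => Wp p (μ : Measure X) (ν : Measure X))
        (fun μ => μ.map (f := φ) hφ.measurable.aemeasurable) ε n
      have hs0 : 0 ≤ Real.log s := Real.log_natCast_nonneg s
      have ht0 : 0 ≤ Real.log t := Real.log_natCast_nonneg t
      have hst : J * Real.log s ≤ Real.log t := by
        rcases Nat.eq_zero_or_pos s with h0 | h0
        · rw [h0]; simpa using ht0
        · rw [← Real.log_pow]
          have : (0 : ℝ) < s := by exact_mod_cast h0
          exact Real.log_le_log (by positivity) (by exact_mod_cast hpow)
      rw [← mul_div_assoc, mul_comm (n : ℝ), ← div_div]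
      gcongr
      rw [le_div_iff₀ hL]
      calc c * Real.log s * |Real.log ε| = (c * |Real.log ε|) * Real.log s := by ring
        _ ≤ J * Real.log s := by gcongr
        _ ≤ _ := hst
    have hpl : 0 < p / Real.log 2 := by positivity
    have htend : Tendsto (fun c : ℝ => ENNReal.ofReal c * H) (𝓝[<] (p / Real.log 2))
        (𝓝 (ENNReal.ofReal (p / Real.log 2) * H)) := by
      refine ENNReal.Tendsto.mul_const ?_ (Or.inl ?_)
      · exact (ENNReal.continuous_ofReal.tendsto _).mono_left nhdsWithin_le_nhds
      · simpa using hpl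
    refine le_of_tendsto htend ?_
    filter_upwards [Ioo_mem_nhdsLT hpl] with c hc
    exact hlow c hc.1 hc.2
  rw [mul_comm, mul_div_assoc, ← ENNReal.ofReal_div_of_pos hl2, mul_comm]
  unfold htop
  rw [ENNReal.mul_iSup]
  refine iSup_le fun ε0 => ?_
  rw [ENNReal.mul_iSup]
  exact iSup_le fun h0 => main ε0 h0
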